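/- Let K be an infinite field with char(K) ≠ 2, let n ∈ ℕ, and let R ∈ gl_n(K) be a skew-symmetric matrix and W ∈ K^{n×k} a matrix of rank k, where GL_n acts on pairs by g·(R, W) = (gRg^T, gW). Then the Zariski closure of the GL_n-orbit of (R, W) inside {skew-symmetric n×n matrices} ⊕ K^{n×k} contains every pair (Q, V) with Q skew-symmetric of rank at most rk(R) − 2k and V ∈ K^{n×k} arbitrary. -/

import Mathlib

open Matrix

/-- Zariski-closed subsets of the space of pairs (skew-symmetric part ambient in
`gl_n`, an `n × k` matrix). -/
def PZClosed {K : Type*} [Field K] {n k : ℕ}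
    (S : Set (Matrix (Fin n) (Fin n) K × Matrix (Fin n) (Fin k) K)) : Prop :=
  ∃ T : Set (MvPolynomial ((Fin n × Fin n) ⊕ (Fin n × Fin k)) K),
    S = {x | ∀ f ∈ T,
      MvPolynomial.eval
        (Sum.elim (fun p => x.1 p.1 p.2) (fun p => x.2 p.1 p.2)) f = 0}

/-- The Zariski closure of a set of pairs. -/
def pzclosure {K : Type*} [Field K] {n k : ℕ}
    (S : Set (Matrix (Fin n) (Fin n) K × Matrix (Fin n) (Fin k) K)) :
    Set (Matrix (Fin n) (Fin n) K × Matrix (Fin n) (Fin k) K) :=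
  ⋂₀ {C | PZClosed C ∧ S ⊆ C}

/-- Subadditivity of the matrix rank. -/
theorem aux_rank_add_le {K : Type*} [Field K] {m n : Type*} [Fintype m] [Fintype n]
    (A B : Matrix m n K) : (A + B).rank ≤ A.rank + B.rank := by
  unfold Matrix.rank
  rw [Matrix.mulVecLin_add]
  calc _ ≤ Module.finrank K (↥(LinearMap.range A.mulVecLin ⊔ LinearMap.range B.mulVecLin)) := by
        apply Submodule.finrank_mono
        rintro _ ⟨x, rfl⟩
        exact Submodule.add_mem_sup ⟨x, rfl⟩ ⟨x, rfl⟩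
    _ ≤ _ := Submodule.finrank_add_le_finrank_add_finrank _ _

theorem aux_rank_neg {K : Type*} [Field K] {m n : Type*} [Fintype m] [Fintype n]
    (A : Matrix m n K) : (-A).rank = A.rank := by
  classical
  apply le_antisymm
  · have : -A = A * (-1 : Matrix n n K) := by simp
    rw [this]
    exact Matrix.rank_mul_le_left _ _
  · have : A = (-A) * (-1 : Matrix n n K) := by simp
    conv_lhs => rw [this]
    exact Matrix.rank_mul_le_left _ _

theorem aux_eq_zero_of_rank {K : Type*} [Field K] {m n : Type*} [Fintype m] [Fintype n]
    (A : Matrix m n K) (h : A.rank = 0) : A = 0 := by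
  classical
  unfold Matrix.rank at h
  rw [Submodule.finrank_eq_zero, LinearMap.range_eq_bot] at h
  apply Matrix.toLin'.injective
  rw [Matrix.toLin'_apply', h, map_zero]

/-- Generalized inverse. -/
theorem aux_ginv {K : Type*} [Field K] {m n : Type*} [Fintype m] [Fintype n]
    (M : Matrix m n K) : ∃ G : Matrix n m K, M * G * M = M := by
  classical
  obtain ⟨s, hs⟩ := (Matrix.toLin' M).rangeRestrict.exists_rightInverse_of_surjective
    (LinearMap.range_rangeRestrict _)
  obtain ⟨g, hg⟩ := s.exists_extend
  refine ⟨LinearMap.toMatrix' g, ?_⟩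
  apply Matrix.toLin'.injective
  rw [Matrix.toLin'_mul, Matrix.toLin'_mul, Matrix.toLin'_toMatrix']
  refine LinearMap.ext fun x => ?_
  have h1 := LinearMap.congr_fun hg ((Matrix.toLin' M).rangeRestrict x)
  have h2 := congrArg Subtype.val (LinearMap.congr_fun hs ((Matrix.toLin' M).rangeRestrict x))
  simp only [LinearMap.comp_apply] at h1 h2 ⊢
  have h3 : g (Matrix.toLin' M x) = s ((Matrix.toLin' M).rangeRestrict x) := h1
  rw [h3]
  exact h2

theorem aux_left_inv {K : Type*} [Field K] {m n : Type*} [Fintype m] [Fintype n]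
    [DecidableEq n] (W : Matrix m n K) (hW : Fintype.card n ≤ W.rank) :
    ∃ L : Matrix n m K, L * W = 1 := by
  obtain ⟨G, hG⟩ := aux_ginv W
  refine ⟨G, ?_⟩
  have h0 : W * (G * W - 1) = 0 := by
    rw [Matrix.mul_sub, ← Matrix.mul_assoc, hG, Matrix.mul_one, sub_self]
  have := Matrix.rank_add_rank_le_card_of_mul_eq_zero h0
  have h2 := aux_eq_zero_of_rank (G * W - 1) (by omega)
  exact sub_eq_zero.mp h2

/-- One peeling step for skew matrices. -/
theorem aux_peel {K : Type*} [Field K] {n : ℕ}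
    (M M' : Matrix (Fin n) (Fin n) K) (i j : Fin n) (x y : Fin n → K)
    (hsub : ∀ w, ∃ z, M' *ᵥ w = M *ᵥ z)
    (hi : ∀ w, (M' *ᵥ w) i = 0) (hj : ∀ w, (M' *ᵥ w) j = 0)
    (hxi : (M *ᵥ x) i = 0) (hxj : (M *ᵥ x) j ≠ 0)
    (hyi : (M *ᵥ y) i ≠ 0) (hyj : (M *ᵥ y) j = 0) : M'.rank + 2 ≤ M.rank := by
  let f : (Fin n → K) →ₗ[K] (K × K) := (LinearMap.proj i).prod (LinearMap.proj j)
  let g : ↥(LinearMap.range M.mulVecLin) →ₗ[K] (K × K) :=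
    f.comp (LinearMap.range M.mulVecLin).subtype
  have hg : LinearMap.range g = ⊤ := by
    rw [LinearMap.range_eq_top]
    rintro ⟨a, b⟩
    refine ⟨⟨M *ᵥ ((b / (M *ᵥ x) j) • x + (a / (M *ᵥ y) i) • y), ⟨_, rfl⟩⟩, ?_⟩
    simp [g, f, Matrix.mulVec_add, Matrix.mulVec_smul, hxi, hyj, hxj, hyi]
  have hrn := LinearMap.finrank_range_add_finrank_ker g
  rw [hg, finrank_top, Module.finrank_prod, Module.finrank_self] at hrn
  have hle : LinearMap.range M'.mulVecLin ≤
      (LinearMap.ker g).map (LinearMap.range M.mulVecLin).subtype := by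
    rintro _ ⟨w, rfl⟩
    obtain ⟨z, hz⟩ := hsub w
    refine ⟨⟨M *ᵥ z, ⟨z, rfl⟩⟩, ?_, ?_⟩
    · simp [g, f, ← hz, hi, hj]
    · simp [hz]
  have h1 := Submodule.finrank_mono hle
  have h2 := Submodule.finrank_map_le (LinearMap.range M.mulVecLin).subtype (LinearMap.ker g)
  unfold Matrix.rank
  omega

/-- Every skew-symmetric matrix is `U Vᵀ - V Uᵀ` with `U, V` having `s ≤ rank / 2` columns. -/
theorem aux_skew_decomp {K : Type*} [Field K] (h2 : (2 : K) ≠ 0) {n : ℕ} (r : ℕ) :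
    ∀ (M : Matrix (Fin n) (Fin n) K), Mᵀ = -M → M.rank ≤ r →
    ∃ (s : ℕ) (U V : Matrix (Fin n) (Fin s) K), 2 * s ≤ M.rank ∧ M = U * Vᵀ - V * Uᵀ := by
  induction r using Nat.strong_induction_on with
  | _ r ih =>
  intro M hM hr
  by_cases h0 : M = 0
  · exact ⟨0, 0, 0, by simp, by simp [h0]⟩
  have hex : ∃ i j, M i j ≠ 0 := by
    by_contra! h
    exact h0 (by ext i j; simpa using h i j)
  obtain ⟨i, j, hij⟩ := hex
  have hsk : ∀ a b, M a b = - M b a := fun a b => by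
    have := congrFun (congrFun hM b) a
    simpa using this
  have hdiag : ∀ a, M a a = 0 := fun a => by
    have h := hsk a a
    have : 2 * M a a = 0 := by linear_combination h
    exact (mul_eq_zero.mp this).resolve_left h2
  have hji : M j i ≠ 0 := by rw [hsk]; simpa using hij
  let u : Fin n → K := fun a => M a i
  let v : Fin n → K := fun a => M a j * (M i j)⁻¹
  let M' : Matrix (Fin n) (Fin n) K := M - (Matrix.vecMulVec u v - Matrix.vecMulVec v u)
  have hM'sk : M'ᵀ = -M' := by
    ext a b
    simp only [M', Matrix.transpose_apply, Matrix.sub_apply, Matrix.vecMulVec_apply,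
      Matrix.neg_apply]
    rw [hsk b a]; ring
  have hM'i : ∀ b, M' i b = 0 := fun b => by
    simp only [M', Matrix.sub_apply, Matrix.vecMulVec_apply, u, v]
    rw [hdiag i, hsk b i]; field_simp; ring
  have hM'j : ∀ b, M' j b = 0 := fun b => by
    simp only [M', Matrix.sub_apply, Matrix.vecMulVec_apply, u, v]
    rw [hdiag j, hsk b j, hsk j i]; field_simp; ring
  have hrank : M'.rank + 2 ≤ M.rank := by
    apply aux_peel M M' i j (Pi.single i 1) (Pi.single j 1)
    · intro w
      refine ⟨w - (v ⬝ᵥ w) • Pi.single i 1 + ((u ⬝ᵥ w) * (M i j)⁻¹) • Pi.single j 1, ?_⟩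
      simp only [M', Matrix.sub_mulVec, Matrix.mulVec_add, Matrix.mulVec_sub, Matrix.mulVec_smul]
      ext a
      simp [u, v, Matrix.vecMulVec_mulVec]
      ring
    · intro w; simp [Matrix.mulVec, dotProduct, hM'i]
    · intro w; simp [Matrix.mulVec, dotProduct, hM'j]
    · simpa using hdiag i
    · simpa using hji
    · simpa using hij
    · simpa using hdiag j
  obtain ⟨s, U, V, hs, hUV⟩ := ih M'.rank (by omega) M' hM'sk le_rfl
  refine ⟨s + 1, Matrix.of fun a => Fin.cons (u a) (U a), Matrix.of fun a => Fin.cons (v a) (V a),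
    by omega, ?_⟩
  have hMM : M = M' + (Matrix.vecMulVec u v - Matrix.vecMulVec v u) := by simp [M']
  rw [hMM, hUV]
  ext a b
  simp [Matrix.mul_apply, Fin.sum_univ_succ, Matrix.vecMulVec_apply]
  ring

/-- The case `k = 0`, solved exactly by a (non-invertible) matrix. -/
theorem aux_skew_hom {K : Type*} [Field K] (h2 : (2 : K) ≠ 0) {n : ℕ}
    (S Q : Matrix (Fin n) (Fin n) K) (hS : Sᵀ = -S) (hQ : Qᵀ = -Q) (hr : Q.rank ≤ S.rank) :
    ∃ X : Matrix (Fin n) (Fin n) K, X * S * Xᵀ = Q := by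
  obtain ⟨s, U, V, hs, hSe⟩ := aux_skew_decomp h2 S.rank S hS le_rfl
  obtain ⟨q, A, B, hq, hQe⟩ := aux_skew_decomp h2 Q.rank Q hQ le_rfl
  have hqs : q ≤ s := by
    have h1 : S.rank ≤ 2 * s := by
      rw [hSe, sub_eq_add_neg]
      have a1 := aux_rank_add_le (U * Vᵀ) (-(V * Uᵀ))
      rw [aux_rank_neg] at a1
      have a2 := (Matrix.rank_mul_le_left U Vᵀ).trans (Matrix.rank_le_width U)
      have a3 := (Matrix.rank_mul_le_left V Uᵀ).trans (Matrix.rank_le_width V)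
      omega
    omega
  have hcr : Fintype.card (Fin s ⊕ Fin s) ≤ (Matrix.fromCols U V).rank := by
    have h1 : S = Matrix.fromCols U V * Matrix.fromRows Vᵀ (-Uᵀ) := by
      rw [Matrix.fromCols_mul_fromRows, hSe, Matrix.mul_neg, sub_eq_add_neg]
    have h3 := Matrix.rank_mul_le_left (Matrix.fromCols U V) (Matrix.fromRows Vᵀ (-Uᵀ))
    rw [← h1] at h3
    simp; omega
  obtain ⟨L, hL⟩ := aux_left_inv _ hcr
  rw [← Matrix.fromRows_toRows L, Matrix.fromRows_mul_fromCols, ← Matrix.fromBlocks_one,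
    Matrix.fromBlocks_inj] at hL
  obtain ⟨e11, e12, e21, e22⟩ := hL
  set L1 := L.toRows₁
  set L2 := L.toRows₂
  let ι : Matrix (Fin q) (Fin s) K := Matrix.of fun a b => if Fin.castLE hqs a = b then 1 else 0
  have hι : ι * ιᵀ = 1 := by
    ext a b
    simp [ι, Matrix.mul_apply, Matrix.one_apply, eq_comm]
  let X : Matrix (Fin n) (Fin n) K := A * ι * L1 + B * ι * L2
  have hXU : X * U = A * ι := by
    simp only [X, Matrix.add_mul, Matrix.mul_assoc, e11, e21]; simp
  have hXV : X * V = B * ι := by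
    simp only [X, Matrix.add_mul, Matrix.mul_assoc, e12, e22]; simp
  refine ⟨X, ?_⟩
  have hl : X * S * Xᵀ = (X * U) * (X * V)ᵀ - (X * V) * (X * U)ᵀ := by
    rw [hSe]
    simp only [Matrix.mul_sub, Matrix.sub_mul, Matrix.transpose_mul, Matrix.mul_assoc]
  have hc : ∀ C D : Matrix (Fin n) (Fin q) K, (C * ι) * (D * ι)ᵀ = C * Dᵀ := fun C D => by
    rw [Matrix.transpose_mul, Matrix.mul_assoc, ← Matrix.mul_assoc ι, hι, Matrix.one_mul]
  rw [hl, hXU, hXV, hc, hc, ← hQe]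

/-- Density of `GL_n` in the space of matrices, for orbit closures. -/
theorem aux_density {K : Type*} [Field K] [Infinite K] {n k : ℕ}
    (R : Matrix (Fin n) (Fin n) K) (W : Matrix (Fin n) (Fin k) K)
    (g : Matrix (Fin n) (Fin n) K) :
    (g * R * gᵀ, g * W) ∈ pzclosure {p | ∃ g : (Matrix (Fin n) (Fin n) K)ˣ,
        p = ((g : Matrix (Fin n) (Fin n) K) * R * (g : Matrix (Fin n) (Fin n) K)ᵀ,
             (g : Matrix (Fin n) (Fin n) K) * W)} := by
  rintro C ⟨⟨T, rfl⟩, hC⟩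
  intro f hf
  let G : Matrix (Fin n) (Fin n) (Polynomial K) := (-g).charmatrix
  let R' : Matrix (Fin n) (Fin n) (Polynomial K) := R.map Polynomial.C
  let W' : Matrix (Fin n) (Fin k) (Polynomial K) := W.map Polynomial.C
  let p : Polynomial K := MvPolynomial.aeval
    (Sum.elim (fun p => (G * R' * Gᵀ) p.1 p.2) (fun p => (G * W') p.1 p.2)) f
  have hG : ∀ t : K, G.map (Polynomial.evalRingHom t) = Matrix.scalar (Fin n) t + g := by
    intro t
    ext a b
    by_cases hab : a = b
    · subst hab; simp [G, Matrix.charmatrix_apply_eq]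
    · simp [G, Matrix.charmatrix_apply_ne _ _ _ hab, hab]
  have hR' : ∀ t : K, R'.map (Polynomial.evalRingHom t) = R := by
    intro t; ext a b; simp [R']
  have hW' : ∀ t : K, W'.map (Polynomial.evalRingHom t) = W := by
    intro t; ext a b; simp [W']
  have hp : ∀ t : K, p.eval t = MvPolynomial.eval
      (Sum.elim (fun p => ((Matrix.scalar (Fin n) t + g) * R * (Matrix.scalar (Fin n) t + g)ᵀ)
        p.1 p.2) (fun p => ((Matrix.scalar (Fin n) t + g) * W) p.1 p.2)) f := by
    intro t
    have h1 : (G * R' * Gᵀ).map (Polynomial.evalRingHom t) =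
        (Matrix.scalar (Fin n) t + g) * R * (Matrix.scalar (Fin n) t + g)ᵀ := by
      rw [Matrix.map_mul, Matrix.map_mul, Matrix.transpose_map, hG, hR']
    have h2 : (G * W').map (Polynomial.evalRingHom t) = (Matrix.scalar (Fin n) t + g) * W := by
      rw [Matrix.map_mul, hG, hW']
    rw [← h1, ← h2]
    change Polynomial.evalRingHom t (MvPolynomial.aeval _ f) = _
    rw [MvPolynomial.aeval_def, MvPolynomial.hom_eval₂, MvPolynomial.eval, MvPolynomial.coe_eval₂Hom]
    congr 1
    · ext x; simp
    · ext x; rcases x with x | x <;> rfl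
  have hprod : (-g).charpoly * p = 0 := by
    apply Polynomial.funext
    intro t
    rw [Polynomial.eval_mul, Polynomial.eval_zero, Matrix.eval_charpoly, sub_neg_eq_add, hp]
    by_cases hd : (Matrix.scalar (Fin n) t + g).det = 0
    · rw [hd, zero_mul]
    · have hu : IsUnit (Matrix.scalar (Fin n) t + g) := by
        rw [Matrix.isUnit_iff_isUnit_det]; exact isUnit_iff_ne_zero.mpr hd
      obtain ⟨w, hw⟩ := hu
      have := hC ⟨w, rfl⟩ f hf
      rw [← hw]
      rw [this, mul_zero]
  have hp0 : p = 0 := (mul_eq_zero.mp hprod).resolve_left (Matrix.charpoly_monic _).ne_zero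
  have := hp 0
  rw [hp0] at this
  simpa using this.symm

theorem aux_final {K : Type*} [Field K] (h2 : (2 : K) ≠ 0) {n k : ℕ}
    (W V : Matrix (Fin n) (Fin k) K) (L : Matrix (Fin k) (Fin n) K) (hL : L * W = 1)
    (A : Matrix (Fin k) (Fin k) K) (B : Matrix (Fin k) (Fin n) K)
    (D G Q : Matrix (Fin n) (Fin n) K) (hA : Aᵀ = -A) (hD : Dᵀ = -D) (hQ : Qᵀ = -Q)
    (hLD : L * D = 0) (hLB : L * Bᵀ = 0) (hG : D * G * D = D) (hB : B * G * D = 0)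
    (hr : Q.rank + A.rank ≤ D.rank) :
    ∃ g : Matrix (Fin n) (Fin n) K,
      g * (W * A * Wᵀ + W * B - Bᵀ * Wᵀ + D) * gᵀ = Q ∧ g * W = V := by
  have hGt : D * Gᵀ * D = -D := by
    have h := congrArg Matrix.transpose hG
    simpa [Matrix.transpose_mul, hD, Matrix.mul_assoc] using h
  obtain ⟨X, hX⟩ := aux_skew_hom h2 D (Q - V * A * Vᵀ) hD
    (by simp [Matrix.transpose_mul, hA, hQ, Matrix.mul_assoc]; abel) (by
      have a1 := aux_rank_add_le Q (-(V * A * Vᵀ))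
      rw [aux_rank_neg, ← sub_eq_add_neg] at a1
      have a2 := Matrix.rank_mul_le_left (V * A) Vᵀ
      have a3 := Matrix.rank_mul_le_right V A
      omega)
  let H : Matrix (Fin n) (Fin n) K := -(X * D * Gᵀ)
  have hHD : H * D = X * D := by
    simp only [H, Matrix.neg_mul]
    rw [Matrix.mul_assoc, Matrix.mul_assoc, ← Matrix.mul_assoc D, hGt]; simp
  have hHt : Hᵀ = G * D * Xᵀ := by
    simp [H, Matrix.transpose_mul, hD, Matrix.mul_assoc]
  have hHDH : H * D * Hᵀ = X * D * Xᵀ := by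
    rw [hHD, hHt, Matrix.mul_assoc, ← Matrix.mul_assoc D, ← Matrix.mul_assoc D, hG,
      Matrix.mul_assoc]
  have hBH : B * Hᵀ = 0 := by
    rw [hHt, ← Matrix.mul_assoc, ← Matrix.mul_assoc, hB, Matrix.zero_mul]
  let g : Matrix (Fin n) (Fin n) K := V * L + H * (1 - W * L)
  have hgW : g * W = V := by
    simp only [g, Matrix.add_mul, Matrix.mul_assoc, Matrix.sub_mul, hL]; simp
  have hgD : g * D = H * D := by
    simp only [g, Matrix.add_mul, Matrix.mul_assoc, Matrix.sub_mul, hLD]; simp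
  have hgB : g * Bᵀ = 0 := by
    have : H * Bᵀ = 0 := by
      have := congrArg Matrix.transpose hBH
      simpa [Matrix.transpose_mul] using this
    simp only [g, Matrix.add_mul, Matrix.mul_assoc, Matrix.sub_mul, hLB]; simp [this]
  have hBg : B * gᵀ = 0 := by
    have := congrArg Matrix.transpose hgB
    simpa [Matrix.transpose_mul] using this
  have hDg : D * gᵀ = D * Hᵀ := by
    have := congrArg Matrix.transpose hgD
    simpa [Matrix.transpose_mul, hD] using this
  refine ⟨g, ?_, hgW⟩
  have e1 : g * (W * A * Wᵀ + W * B - Bᵀ * Wᵀ + D) * gᵀ =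
      (g * W) * A * (g * W)ᵀ + (g * W) * (B * gᵀ) - (g * Bᵀ) * (g * W)ᵀ + g * (D * gᵀ) := by
    simp only [Matrix.mul_add, Matrix.mul_sub, Matrix.add_mul, Matrix.sub_mul,
      Matrix.transpose_mul, Matrix.mul_assoc]
  rw [e1, hgW, hBg, hgB, hDg, ← Matrix.mul_assoc, hgD, hHDH, hX]
  simp

theorem aux_exact {K : Type*} [Field K] (h2 : (2 : K) ≠ 0) {n k : ℕ}
    (R Q : Matrix (Fin n) (Fin n) K) (hR : Rᵀ = -R) (hQ : Qᵀ = -Q)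
    (W V : Matrix (Fin n) (Fin k) K) (hW : W.rank = k) (hr : Q.rank + 2 * k ≤ R.rank) :
    ∃ g : Matrix (Fin n) (Fin n) K, g * R * gᵀ = Q ∧ g * W = V := by
  obtain ⟨L, hL⟩ := aux_left_inv W (by simp [hW])
  obtain ⟨e, he⟩ : ∃ e : Matrix (Fin n) (Fin n) K, e = 1 - W * L := ⟨_, rfl⟩
  have heW : e * W = 0 := by
    rw [he, Matrix.sub_mul, Matrix.mul_assoc, hL]; simp
  have hLe : L * e = 0 := by
    rw [he, Matrix.mul_sub, ← Matrix.mul_assoc, hL]; simp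
  have hee : e * e = e := by
    nth_rw 2 [he]
    rw [Matrix.mul_sub, ← Matrix.mul_assoc, heW]; simp
  have hone : W * L + e = 1 := by rw [he]; abel
  obtain ⟨A, hA⟩ : ∃ A, A = L * R * Lᵀ := ⟨_, rfl⟩
  obtain ⟨B, hB⟩ : ∃ B, B = L * R * eᵀ := ⟨_, rfl⟩
  obtain ⟨D, hD⟩ : ∃ D, D = e * R * eᵀ := ⟨_, rfl⟩
  have hAs : Aᵀ = -A := by rw [hA]; simp [Matrix.transpose_mul, hR, Matrix.mul_assoc]
  have hBt : e * R * Lᵀ = -Bᵀ := by rw [hB]; simp [Matrix.transpose_mul, hR, Matrix.mul_assoc]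
  have hDs : Dᵀ = -D := by rw [hD]; simp [Matrix.transpose_mul, hR, Matrix.mul_assoc]
  have hLD : L * D = 0 := by rw [hD, ← Matrix.mul_assoc, ← Matrix.mul_assoc, hLe]; simp
  have hLBt : L * Bᵀ = 0 := by
    rw [← neg_eq_zero, ← Matrix.mul_neg, ← hBt, ← Matrix.mul_assoc, ← Matrix.mul_assoc, hLe]; simp
  obtain ⟨G, hG⟩ := aux_ginv D
  have hGt : D * Gᵀ * D = -D := by
    have h := congrArg Matrix.transpose hG
    simpa [Matrix.transpose_mul, hDs, Matrix.mul_assoc] using h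
  obtain ⟨N, hN⟩ : ∃ N, N = 1 - G * D := ⟨_, rfl⟩
  have hDN : D * N = 0 := by
    rw [hN, Matrix.mul_sub, ← Matrix.mul_assoc, hG]; simp
  have hND : Nᵀ * D = 0 := by
    have h := congrArg Matrix.transpose hDN
    simpa [Matrix.transpose_mul, hDs] using h
  obtain ⟨M, hM⟩ : ∃ M, M = B * N := ⟨_, rfl⟩
  have hMG : M * G * D = 0 := by
    rw [hM, hN, Matrix.mul_assoc, Matrix.mul_assoc, Matrix.sub_mul, Matrix.one_mul,
      Matrix.mul_assoc, ← Matrix.mul_assoc D, hG]; simp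
  obtain ⟨C, hC⟩ := aux_ginv M
  obtain ⟨A1, hA1⟩ : ∃ A1, A1 = A - B * Gᵀ * Bᵀ + B * G * Bᵀ + B * G * D * Gᵀ * Bᵀ := ⟨_, rfl⟩
  have hA1s : A1ᵀ = -A1 := by
    rw [hA1]; simp [Matrix.transpose_mul, hAs, hDs, Matrix.mul_assoc]; abel
  obtain ⟨P, hP⟩ : ∃ P, P = 1 - M * C := ⟨_, rfl⟩
  have hPrank : P.rank + M.rank ≤ k := by
    have h0 : P * M = 0 := by rw [hP, Matrix.sub_mul, hC]; simp
    simpa using Matrix.rank_add_rank_le_card_of_mul_eq_zero h0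
  obtain ⟨Z2, hZ2⟩ : ∃ Z2, Z2 = A1 * Cᵀ - (2⁻¹ : K) • (M * C * A1 * Cᵀ) := ⟨_, rfl⟩
  have hPA : P * A1 * Pᵀ = A1 + M * Z2ᵀ - Z2 * Mᵀ := by
    have hh : ∀ x : Matrix (Fin k) (Fin k) K, x = (2⁻¹ : K) • x + (2⁻¹ : K) • x := by
      intro x
      rw [← add_smul, ← two_mul, mul_inv_cancel₀ h2, one_smul]
    rw [hP, hZ2]
    simp only [Matrix.transpose_sub, Matrix.transpose_mul, Matrix.transpose_smul,
      Matrix.transpose_transpose, Matrix.transpose_one, hA1s, Matrix.sub_mul, Matrix.mul_sub,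
      Matrix.mul_neg, Matrix.neg_mul, Matrix.one_mul, Matrix.mul_one, Matrix.smul_mul,
      Matrix.mul_smul, Matrix.mul_assoc, smul_neg]
    conv_lhs => rw [hh (M * (C * (A1 * (Cᵀ * Mᵀ))))]
    abel
  obtain ⟨Z, hZ⟩ : ∃ Z, Z = Z2 * Nᵀ - B * G := ⟨_, rfl⟩
  have hZD : B + Z * D = M := by
    rw [hZ, hM, Matrix.sub_mul, Matrix.mul_assoc Z2, hND, hN]
    simp [Matrix.mul_sub, Matrix.mul_assoc]; abel
  have hA' : A + B * Zᵀ - Z * Bᵀ + Z * D * Zᵀ = P * A1 * Pᵀ := by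
    have hDNX : ∀ Y : Matrix (Fin n) (Fin k) K, D * (N * Y) = 0 := fun Y => by
      rw [← Matrix.mul_assoc, hDN, Matrix.zero_mul]
    have hNDX : ∀ Y : Matrix (Fin n) (Fin k) K, Nᵀ * (D * Y) = 0 := fun Y => by
      rw [← Matrix.mul_assoc, hND, Matrix.zero_mul]
    rw [hPA, hA1, hZ, hM]
    simp only [Matrix.transpose_sub, Matrix.transpose_mul, 
      Matrix.transpose_transpose, Matrix.sub_mul, Matrix.mul_sub,
      Matrix.mul_assoc, hDNX, hNDX, Matrix.mul_zero]
    abel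
  -- the unipotent change of coordinates
  obtain ⟨T, hT⟩ : ∃ T, T = 1 + W * Z * e := ⟨_, rfl⟩
  obtain ⟨T', hT'⟩ : ∃ T', T' = 1 - W * Z * e := ⟨_, rfl⟩
  have hnil : W * Z * e * (W * Z * e) = 0 := by
    rw [Matrix.mul_assoc W, Matrix.mul_assoc, ← Matrix.mul_assoc (Z * e), Matrix.mul_assoc Z,
      heW]; simp
  have hTT : T' * T = 1 := by
    rw [hT, hT', Matrix.mul_add, Matrix.sub_mul, Matrix.sub_mul, hnil]; simp
  have hTW : T * W = W := by
    rw [hT, Matrix.add_mul, Matrix.mul_assoc _ e, heW]; simp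
  have hRdec : R = W * A * Wᵀ + W * B - Bᵀ * Wᵀ + D := by
    have h1 : R = (W * L + e) * R * (W * L + e)ᵀ := by rw [hone]; simp
    have h3 : W * A * Wᵀ + W * B - Bᵀ * Wᵀ + D =
        W * A * Wᵀ + W * B + (-Bᵀ) * Wᵀ + D := by rw [Matrix.neg_mul, sub_eq_add_neg (_ + _)]
    rw [h3, ← hBt, hA, hB, hD]
    conv_lhs => rw [h1]
    simp only [Matrix.transpose_add, Matrix.transpose_mul, Matrix.add_mul, Matrix.mul_add,
      Matrix.mul_assoc]
    abel
  have heD : e * D = D := by rw [hD, ← Matrix.mul_assoc, ← Matrix.mul_assoc, hee]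
  have heB : e * Bᵀ = Bᵀ := by
    rw [← neg_inj, ← Matrix.mul_neg, ← hBt, ← Matrix.mul_assoc, ← Matrix.mul_assoc, hee]
  have hTD : T * D = D + W * Z * D := by
    rw [hT, Matrix.add_mul, Matrix.mul_assoc _ e, heD]; simp
  have hTB : T * Bᵀ = Bᵀ + W * Z * Bᵀ := by
    rw [hT, Matrix.add_mul, Matrix.mul_assoc _ e, heB]; simp
  have hBT : B * Tᵀ = B + B * Zᵀ * Wᵀ := by
    have := congrArg Matrix.transpose hTB
    simpa [Matrix.transpose_mul, Matrix.mul_assoc] using this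
  have hDT : D * Tᵀ = D + D * Zᵀ * Wᵀ := by
    have := congrArg Matrix.transpose hTD
    simp only [Matrix.transpose_mul, Matrix.transpose_add, hDs, Matrix.neg_mul, Matrix.mul_neg,
      ← neg_add, neg_inj] at this
    rw [this, Matrix.mul_assoc]
  have hR' : T * R * Tᵀ = W * (P * A1 * Pᵀ) * Wᵀ + W * M - Mᵀ * Wᵀ + D := by
    have e1 : T * R * Tᵀ =
        (T * W) * A * (T * W)ᵀ + (T * W) * (B * Tᵀ) - (T * Bᵀ) * (T * W)ᵀ + T * (D * Tᵀ) := by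
      conv_lhs => rw [hRdec]
      simp only [Matrix.mul_add, Matrix.mul_sub, Matrix.add_mul, Matrix.sub_mul,
        Matrix.transpose_mul, Matrix.mul_assoc]
    have e2 : T * (D * Zᵀ * Wᵀ) = (T * D) * Zᵀ * Wᵀ := by simp only [Matrix.mul_assoc]
    rw [e1, hTW, hBT, hTB, hDT, Matrix.mul_add T, e2, hTD, ← hA', ← hZD]
    simp only [Matrix.mul_add, Matrix.mul_sub, Matrix.add_mul, Matrix.sub_mul,
        Matrix.transpose_mul, Matrix.transpose_add, Matrix.mul_assoc, hDs, Matrix.neg_mul]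
    abel
  have hrankR : R.rank ≤ (T * R * Tᵀ).rank := by
    have h1 : R = T' * (T * R * Tᵀ) * T'ᵀ := by
      have : T' * (T * R * Tᵀ) * T'ᵀ = (T' * T) * R * (T' * T)ᵀ := by
        simp only [Matrix.transpose_mul, Matrix.mul_assoc]
      rw [this, hTT]; simp
    conv_lhs => rw [h1]
    exact (Matrix.rank_mul_le_left _ _).trans (Matrix.rank_mul_le_right _ _)
  have hrk2 : (T * R * Tᵀ).rank ≤ (P * A1 * Pᵀ).rank + M.rank + M.rank + D.rank := by
    rw [hR', sub_eq_add_neg]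
    have a1 := aux_rank_add_le (W * (P * A1 * Pᵀ) * Wᵀ + W * M + -(Mᵀ * Wᵀ)) D
    have a2 := aux_rank_add_le (W * (P * A1 * Pᵀ) * Wᵀ + W * M) (-(Mᵀ * Wᵀ))
    have a3 := aux_rank_add_le (W * (P * A1 * Pᵀ) * Wᵀ) (W * M)
    have a4 := Matrix.rank_mul_le_left (W * (P * A1 * Pᵀ)) Wᵀ
    have a5 := Matrix.rank_mul_le_right W (P * A1 * Pᵀ)
    have a6 := Matrix.rank_mul_le_right W M
    have a7 := Matrix.rank_mul_le_left Mᵀ Wᵀ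
    rw [Matrix.rank_transpose] at a7
    rw [aux_rank_neg] at a2
    omega
  have hPr : (P * A1 * Pᵀ).rank ≤ P.rank :=
    (Matrix.rank_mul_le_left _ _).trans (Matrix.rank_mul_le_left _ _)
  have hLM : L * Mᵀ = 0 := by
    have h := congrArg Matrix.transpose hLBt
    rw [← hZD, Matrix.transpose_add, Matrix.mul_add, hLBt, Matrix.transpose_mul, hDs,
      ← Matrix.mul_assoc, Matrix.mul_neg, hLD]; simp
  obtain ⟨g, hg1, hg2⟩ := aux_final h2 W V L hL (P * A1 * Pᵀ) M D G Q
    (by simp [Matrix.transpose_mul, hA1s, Matrix.mul_assoc]) hDs hQ hLD hLM hG hMG (by omega)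
  refine ⟨g * T, ?_, by rw [Matrix.mul_assoc, hTW, hg2]⟩
  rw [← hR'] at hg1
  rw [← hg1]
  simp only [Matrix.transpose_mul, Matrix.mul_assoc]

/-- Let `R` be a skew-symmetric `n × n` matrix and `W` an `n × k` matrix of rank `k`,
with `GL_n` acting by `g·(R, W) = (gRgᵀ, gW)`. Then the Zariski closure of the orbit of
`(R, W)` contains every pair `(Q, V)` with `Q` skew-symmetric of rank at most
`rk(R) - 2k`, and `V` arbitrary. -/
theorem orbit_closure_contains_low_rank_pairs {K : Type*} [Field K] [Infinite K]
    (hchar : ringChar K ≠ 2) (n k : ℕ)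
    (R : Matrix (Fin n) (Fin n) K) (hR : R + Rᵀ = 0)
    (W : Matrix (Fin n) (Fin k) K) (hW : W.rank = k) :
    ∀ (Q : Matrix (Fin n) (Fin n) K) (V : Matrix (Fin n) (Fin k) K),
      Q + Qᵀ = 0 → Q.rank + 2 * k ≤ R.rank →
      (Q, V) ∈ pzclosure {p | ∃ g : (Matrix (Fin n) (Fin n) K)ˣ,
        p = ((g : Matrix (Fin n) (Fin n) K) * R * (g : Matrix (Fin n) (Fin n) K)ᵀ,
             (g : Matrix (Fin n) (Fin n) K) * W)} := by
  intro Q V hQ hr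
  have h2 : (2 : K) ≠ 0 := Ring.two_ne_zero hchar
  obtain ⟨g, hg1, hg2⟩ := aux_exact h2 R Q (eq_neg_of_add_eq_zero_right hR)
    (eq_neg_of_add_eq_zero_right hQ) W V hW hr
  rw [← hg1, ← hg2]
  exact aux_density R W g
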